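/- For every n ≥ 6 there exists γ ∈ (0, π) such that every function K : ℝⁿ → ℝ which is locally integrable, continuous on ℝⁿ\{0}, homogeneous of degree 4−n, and a fundamental solution of the uniformly elliptic fourth-order operator L_γ = (Δ′)² + 2cos(γ)Δ′(∂/∂x_n)² + (∂/∂x_n)⁴ attains both signs: there exist y, z ∈ ℝⁿ\{0} with K(y) > 0 and K(z) < 0 (hence, by homogeneity, K changes sign in every punctured neighbourhood of 0). -/

import Mathlib

open MeasureTheory RealInnerProductSpace

noncomputable section

/-- ℝⁿ as a Euclidean space. -/
abbrev En (n : ℕ) : Type := EuclideanSpace ℝ (Fin n)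

/-- The `i`-th standard basis vector of ℝⁿ. -/
def stdB (n : ℕ) (i : Fin n) : En n := EuclideanSpace.single i 1

/-- The symbol Q(ξ) = Σ_{i₁,…,i_{2m}} A_{i₁…i_{2m}} ξ_{i₁}⋯ξ_{i_{2m}}. -/
def symbolQ (n m : ℕ) (A : (Fin (2*m) → Fin n) → ℝ) (ξ : En n) : ℝ :=
  ∑ i : Fin (2*m) → Fin n, A i * ∏ j, ξ (i j)

/-- The constant-coefficient operator
(Lψ)(x) = (−1)^m Σ A_{i₁…i_{2m}} ∂_{i₁}⋯∂_{i_{2m}} ψ(x). -/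
def opL (n m : ℕ) (A : (Fin (2*m) → Fin n) → ℝ) (ψ : En n → ℝ) (x : En n) : ℝ :=
  (-1 : ℝ)^m * ∑ i : Fin (2*m) → Fin n,
    A i * iteratedFDeriv ℝ (2*m) ψ x (fun j => stdB n (i j))

/-- K is a fundamental solution of L: ∫ K(y) (Lψ)(y) dy = ψ(0) for all ψ ∈ C_c^∞. -/
def IsFundamentalSolution (n m : ℕ) (A : (Fin (2*m) → Fin n) → ℝ) (K : En n → ℝ) : Prop :=
  ∀ ψ : En n → ℝ, ContDiff ℝ (⊤ : ℕ∞) ψ → HasCompactSupport ψ →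
    ∫ y, K y * opL n m A ψ y = ψ 0

/-- K is homogeneous of degree a: K(σx) = |σ|^a K(x) for σ ≠ 0, x ≠ 0. -/
def HomogeneousDeg (n : ℕ) (a : ℝ) (K : En n → ℝ) : Prop :=
  ∀ σ : ℝ, σ ≠ 0 → ∀ x : En n, x ≠ 0 → K (σ • x) = |σ| ^ a * K x

/-- The Euclidean Laplacian Δf(x) = Σ_i ∂²f/∂x_i²(x). -/
def lap (n : ℕ) (f : En n → ℝ) (x : En n) : ℝ :=
  ∑ i : Fin n, iteratedFDeriv ℝ 2 f x (fun _ => stdB n i)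

/-- The point (x′, t) ∈ ℝ^{d} × ℝ = ℝ^{d+1}. -/
def snocVec (d : ℕ) (x' : En d) (t : ℝ) : En (d+1) :=
  (EuclideanSpace.equiv (Fin (d+1)) ℝ).symm (Fin.snoc (fun i => x' i) t)

/-- The fourth-order operator L_γ = (Δ′)² + 2cos(γ)Δ′(∂/∂x_n)² + (∂/∂x_n)⁴
on ℝ^{d+1}, acting on smooth functions. -/
def Lgamma (d : ℕ) (γ : ℝ) (ψ : En (d+1) → ℝ) (x : En (d+1)) : ℝ :=
  (∑ i : Fin d, ∑ j : Fin d,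
      iteratedFDeriv ℝ 4 ψ x
        ![stdB (d+1) i.castSucc, stdB (d+1) i.castSucc,
          stdB (d+1) j.castSucc, stdB (d+1) j.castSucc])
  + 2 * Real.cos γ *
    (∑ i : Fin d,
      iteratedFDeriv ℝ 4 ψ x
        ![stdB (d+1) i.castSucc, stdB (d+1) i.castSucc,
          stdB (d+1) (Fin.last d), stdB (d+1) (Fin.last d)])
  + iteratedFDeriv ℝ 4 ψ x
      ![stdB (d+1) (Fin.last d), stdB (d+1) (Fin.last d),
        stdB (d+1) (Fin.last d), stdB (d+1) (Fin.last d)]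

open scoped ContDiff Topology

def Sm {n : ℕ} (f : En n → ℝ) : Prop := ∀ y : En n, y ≠ 0 → ContDiffAt ℝ ∞ f y

def dd {n : ℕ} (a : En n) (f : En n → ℝ) (x : En n) : ℝ :=
  fderiv ℝ (fun y => fderiv ℝ f y a) x a

lemma ne_nhds {n : ℕ} {x : En n} (hx : x ≠ 0) : ∀ᶠ y in 𝓝 x, y ≠ 0 :=
  isOpen_ne.mem_nhds hx

lemma Sm.fd {n : ℕ} {f : En n → ℝ} (hf : Sm f) (a : En n) : Sm (fun y => fderiv ℝ f y a) := by
  intro y hy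
  have h := (hf y hy).fderiv_right (m := ∞) (by simp)
  exact h.clm_apply contDiffAt_const

lemma Sm.dd {n : ℕ} {f : En n → ℝ} (hf : Sm f) (a : En n) : Sm (dd a f) := (hf.fd a).fd a

lemma dd_congr {n : ℕ} {f g : En n → ℝ} (h : ∀ y, y ≠ 0 → f y = g y) (a : En n) {x : En n}
    (hx : x ≠ 0) : dd a f x = dd a g x := by
  unfold dd
  have : (fun y => fderiv ℝ f y a) =ᶠ[𝓝 x] (fun y => fderiv ℝ g y a) := by
    filter_upwards [ne_nhds hx] with y hy
    have : f =ᶠ[𝓝 y] g := by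
      filter_upwards [ne_nhds hy] with z hz using h z hz
    rw [this.fderiv_eq]
  rw [this.fderiv_eq]

lemma Sm.diff {n : ℕ} {f : En n → ℝ} (hf : Sm f) {x : En n} (hx : x ≠ 0) :
    DifferentiableAt ℝ f x := (hf x hx).differentiableAt (by simp)

lemma Sm.lin {n : ℕ} {f g : En n → ℝ} (hf : Sm f) (hg : Sm g) (c e : ℝ) :
    Sm (fun y => c * f y + e * g y) := fun y hy =>
  (contDiffAt_const.mul (hf y hy)).add (contDiffAt_const.mul (hg y hy))

lemma fd_lin {n : ℕ} {f g : En n → ℝ} (hf : Sm f) (hg : Sm g) (c e : ℝ) (a : En n) {x : En n}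
    (hx : x ≠ 0) : fderiv ℝ (fun y => c * f y + e * g y) x a
      = c * fderiv ℝ f x a + e * fderiv ℝ g x a := by
  have h1 := ((hf.diff hx).hasFDerivAt.const_mul c).add ((hg.diff hx).hasFDerivAt.const_mul e)
  have := h1.fderiv
  erw [this]
  simp

lemma dd_lin {n : ℕ} {f g : En n → ℝ} (hf : Sm f) (hg : Sm g) (c e : ℝ) (a : En n) {x : En n}
    (hx : x ≠ 0) : dd a (fun y => c * f y + e * g y) x = c * dd a f x + e * dd a g x := by
  unfold dd
  rw [← fd_lin (hf.fd a) (hg.fd a) c e a hx]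
  apply congrArg (fun (l : En n →L[ℝ] ℝ) => l a)
  apply Filter.EventuallyEq.fderiv_eq
  filter_upwards [ne_nhds hx] with y hy using fd_lin hf hg c e a hy

lemma Sm.sum {n : ℕ} {ι : Type*} (s : Finset ι) {f : ι → En n → ℝ} (hf : ∀ i, Sm (f i)) :
    Sm (fun y => ∑ i ∈ s, f i y) := fun y hy => ContDiffAt.sum (fun i _ => hf i y hy)

lemma fd_sum {n : ℕ} {ι : Type*} (s : Finset ι) {f : ι → En n → ℝ} (hf : ∀ i, Sm (f i))
    (a : En n) {x : En n} (hx : x ≠ 0) :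
    fderiv ℝ (fun y => ∑ i ∈ s, f i y) x a = ∑ i ∈ s, fderiv ℝ (f i) x a := by
  rw [fderiv_fun_sum (fun i _ => (hf i).diff hx)]
  simp

lemma dd_sum {n : ℕ} {ι : Type*} (s : Finset ι) {f : ι → En n → ℝ} (hf : ∀ i, Sm (f i))
    (a : En n) {x : En n} (hx : x ≠ 0) :
    dd a (fun y => ∑ i ∈ s, f i y) x = ∑ i ∈ s, dd a (f i) x := by
  unfold dd
  rw [← fd_sum s (fun i => (hf i).fd a) a hx]
  apply congrArg (fun (l : En n →L[ℝ] ℝ) => l a)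
  apply Filter.EventuallyEq.fderiv_eq
  filter_upwards [ne_nhds hx] with y hy using fd_sum s hf a hy

lemma it_succ {n k : ℕ} {f : En n → ℝ} (hf : Sm f) {x : En n} (hx : x ≠ 0)
    (m : Fin (k+1) → En n) : iteratedFDeriv ℝ (k+1) f x m
      = fderiv ℝ (fun y => iteratedFDeriv ℝ k f y (Fin.tail m)) x (m 0) := by
  rw [iteratedFDeriv_succ_apply_left]
  rw [fderiv_continuousMultilinear_apply_const_apply]
  apply ContDiffAt.differentiableAt_iteratedFDeriv (hf x hx)
  exact_mod_cast ENat.natCast_lt_top k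

lemma it_two {n : ℕ} {f : En n → ℝ} (hf : Sm f) {x : En n} (hx : x ≠ 0) (a : En n) :
    iteratedFDeriv ℝ 2 f x ![a, a] = dd a f x := by
  rw [iteratedFDeriv_two_apply]
  unfold dd
  have : DifferentiableAt ℝ (fderiv ℝ f) x :=
    ((hf x hx).fderiv_right (m := ∞) (by simp)).differentiableAt (by simp)
  rw [fderiv_clm_apply this (by simp)]
  simp

lemma it_four {n : ℕ} {f : En n → ℝ} (hf : Sm f) {x : En n} (hx : x ≠ 0) (a b : En n) :
    iteratedFDeriv ℝ 4 f x ![a, a, b, b] = dd a (dd b f) x := by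
  rw [it_succ hf hx]
  change fderiv ℝ (fun y => iteratedFDeriv ℝ 3 f y ![a, b, b]) x a = _
  conv_rhs => unfold dd
  apply congrArg (fun (l : En n →L[ℝ] ℝ) => l a)
  apply Filter.EventuallyEq.fderiv_eq
  filter_upwards [ne_nhds hx] with y hy
  rw [it_succ hf hy]
  change fderiv ℝ (fun y => iteratedFDeriv ℝ 2 f y ![b, b]) y a = _
  apply congrArg (fun (l : En n →L[ℝ] ℝ) => l a)
  apply Filter.EventuallyEq.fderiv_eq
  filter_upwards [ne_nhds hy] with z hz using it_two hf hz b

lemma dd_eq {n : ℕ} {f f1 : En n → ℝ} {f2 : ℝ} (hf : Sm f) {x : En n} (hx : x ≠ 0) (a : En n)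
    (h1 : ∀ y, y ≠ 0 → HasDerivAt (fun t : ℝ => f (y + t • a)) (f1 y) 0)
    (h2 : HasDerivAt (fun t : ℝ => f1 (x + t • a)) f2 0) : dd a f x = f2 := by
  have e1 : ∀ y, y ≠ 0 → fderiv ℝ f y a = f1 y := fun y hy =>
    HasDerivAt.unique ((hf.diff hy).hasFDerivAt.hasLineDerivAt a) (h1 y hy)
  have e2 := ((hf.fd a).diff hx).hasFDerivAt.hasLineDerivAt a
  have e3 : (fun y => fderiv ℝ f y a) =ᶠ[𝓝 x] f1 := by
    filter_upwards [ne_nhds hx] with y hy using e1 y hy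
  have e4 : HasFDerivAt f1 (fderiv ℝ (fun y => fderiv ℝ f y a) x) x :=
    ((hf.fd a).diff hx).hasFDerivAt.congr_of_eventuallyEq e3.symm
  exact HasDerivAt.unique (e4.hasLineDerivAt a) h2
def ww {d : ℕ} (x : En (d+1)) : ℝ :=
  (∑ i : Fin d, x i.castSucc ^ 2) + 3/4 * x (Fin.last d) ^ 2

def gg {d : ℕ} (j k : ℕ) (x : En (d+1)) : ℝ := x (Fin.last d) ^ (2*j) * (ww x ^ k)⁻¹

lemma ww_pos {d : ℕ} {x : En (d+1)} (hx : x ≠ 0) : 0 < ww x := by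
  by_contra h
  apply hx
  have h0 : 0 ≤ ∑ i : Fin d, x i.castSucc ^ 2 := Finset.sum_nonneg (fun i _ => sq_nonneg _)
  have h1 : 0 ≤ x (Fin.last d) ^ 2 := sq_nonneg _
  unfold ww at h
  have h2 : ∑ i : Fin d, x i.castSucc ^ 2 = 0 := by linarith
  have h3 : x (Fin.last d) ^ 2 = 0 := by linarith
  rw [Finset.sum_eq_zero_iff_of_nonneg (fun i _ => sq_nonneg _)] at h2
  ext i
  refine Fin.lastCases ?_ (fun i => ?_) i
  · simpa using h3
  · simpa using h2 i (Finset.mem_univ _)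

lemma ww_smooth {d : ℕ} : ContDiff ℝ ∞ (ww : En (d+1) → ℝ) := by
  unfold ww
  fun_prop

lemma gg_sm {d : ℕ} (j k : ℕ) : Sm (gg j k : En (d+1) → ℝ) := by
  intro y hy
  unfold gg
  refine ContDiffAt.mul (by fun_prop) (ContDiffAt.inv ?_ (pow_ne_zero _ (ww_pos hy).ne'))
  exact (ww_smooth.contDiffAt).pow k

lemma coord_line {d : ℕ} (y : En d) (i l : Fin d) (t : ℝ) :
    (y + t • stdB d i) l = y l + t * (if l = i then 1 else 0) := by
  simp [stdB]

lemma ww_line {d : ℕ} (y : En (d+1)) (i : Fin d) (t : ℝ) :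
    ww (y + t • stdB (d+1) i.castSucc) = ww y + 2 * t * y i.castSucc + t^2 := by
  unfold ww
  simp only [coord_line, Fin.castSucc_inj]
  have : (Fin.last d = i.castSucc) = False := by
    simpa using (Fin.castSucc_lt_last i).ne'
  simp only [this, if_false, mul_zero, add_zero]
  have : ∀ l : Fin d, (y l.castSucc + t * (if l = i then 1 else 0))^2
     = y l.castSucc ^ 2 + (if l = i then 2 * t * y i.castSucc + t^2 else 0) := by
    intro l
    split_ifs with h
    · subst h; ring
    · ring
  simp only [this, Finset.sum_add_distrib, Finset.sum_ite_eq', Finset.mem_univ, if_true]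
  ring

lemma ww_line' {d : ℕ} (y : En (d+1)) (t : ℝ) :
    ww (y + t • stdB (d+1) (Fin.last d)) = ww y + 3/4 * (2 * t * y (Fin.last d) + t^2) := by
  unfold ww
  simp only [coord_line]
  have : ∀ l : Fin d, (l.castSucc = Fin.last d) = False := by
    intro l; simp
  simp only [this, if_false, if_true, mul_zero, add_zero]
  ring

lemma last_line {d : ℕ} (y : En (d+1)) (i : Fin d) (t : ℝ) :
    (y + t • stdB (d+1) i.castSucc) (Fin.last d) = y (Fin.last d) := by
  have : (Fin.last d = i.castSucc) = False := by
    simpa using (Fin.castSucc_lt_last i).ne'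
  rw [coord_line]
  simp only [this, if_false, mul_zero, add_zero]

lemma dww {d : ℕ} (y : En (d+1)) (i : Fin d) :
    HasDerivAt (fun t : ℝ => ww (y + t • stdB (d+1) i.castSucc)) (2 * y i.castSucc) 0 := by
  simp only [ww_line]
  have h := (((hasDerivAt_id (0:ℝ)).const_mul 2).mul_const (y i.castSucc)).const_add (ww y)
    |>.add ((hasDerivAt_id (0:ℝ)).pow 2)
  refine HasDerivAt.congr_deriv h ?_
  simp

lemma dww' {d : ℕ} (y : En (d+1)) :
    HasDerivAt (fun t : ℝ => ww (y + t • stdB (d+1) (Fin.last d))) (3/2 * y (Fin.last d)) 0 := by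
  simp only [ww_line']
  have h := ((((hasDerivAt_id (0:ℝ)).const_mul 2).mul_const (y (Fin.last d)))
    |>.add ((hasDerivAt_id (0:ℝ)).pow 2)).const_mul (3/4) |>.const_add (ww y)
  refine HasDerivAt.congr_deriv h ?_
  simp
  ring

lemma dcoord {d : ℕ} (y : En d) (i : Fin d) :
    HasDerivAt (fun t : ℝ => (y + t • stdB d i) i) 1 0 := by
  simp only [coord_line, if_true, mul_one]
  exact (hasDerivAt_id (0:ℝ)).const_add _

lemma dpowinv {w : ℝ → ℝ} {w' : ℝ} (hw : HasDerivAt w w' 0) (h0 : w 0 ≠ 0) (k : ℕ) :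
    HasDerivAt (fun t => (w t ^ k)⁻¹) (-(k * w') * (w 0 ^ (k+1))⁻¹) 0 := by
  have h := (hw.pow k).inv (pow_ne_zero k h0)
  refine HasDerivAt.congr_deriv h ?_
  rcases k with _ | k
  · simp
  · simp only [Nat.add_sub_cancel, Pi.pow_apply]
    field_simp
    ring

lemma dd_gg {d : ℕ} (j k : ℕ) {x : En (d+1)} (hx : x ≠ 0) (i : Fin d) :
    dd (stdB (d+1) i.castSucc) (gg j k) x
      = -(2 * k) * gg j (k+1) x + 4 * k * (k+1) * x i.castSucc ^ 2 * gg j (k+2) x := by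
  refine dd_eq (f1 := fun y => -(2 * k) * (y i.castSucc * gg j (k+1) y)) (gg_sm j k) hx _ ?_ ?_
  · intro y hy
    have h := (dpowinv (dww y i) (by simpa using (ww_pos hy).ne') k).const_mul
      (y (Fin.last d) ^ (2*j))
    simp only [gg, last_line]
    refine HasDerivAt.congr_deriv h ?_
    simp
    ring
  · have h := (((dcoord x i.castSucc).mul ((dpowinv (dww x i) (by simpa using (ww_pos hx).ne')
      (k+1)).const_mul (x (Fin.last d) ^ (2*j)))).const_mul (-(2*k : ℝ)))
    simp only [gg, last_line]
    refine HasDerivAt.congr_deriv h ?_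
    simp
    ring

lemma dpow_ {u : ℝ → ℝ} (hu : HasDerivAt u 1 0) (k : ℕ) :
    HasDerivAt (fun t => u t ^ k) (k * u 0 ^ (k-1)) 0 := by
  exact (hu.pow k).congr_deriv (by simp)

lemma dd_gg' {d : ℕ} (j k : ℕ) {x : En (d+1)} (hx : x ≠ 0) :
    dd (stdB (d+1) (Fin.last d)) (gg j k) x
      = 2 * j * (2 * j - 1) * gg (j-1) k x - 3/2 * k * (4 * j + 1) * gg j (k+1) x
        + 9/4 * k * (k+1) * gg (j+1) (k+2) x := by
  refine dd_eq (f1 := fun y => (2 * j : ℕ) * (y (Fin.last d) ^ (2*j-1) * (ww y ^ k)⁻¹)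
    - 3/2 * k * (y (Fin.last d) ^ (2*j+1) * (ww y ^ (k+1))⁻¹)) (gg_sm j k) hx _ ?_ ?_
  · intro y hy
    have h := (dpow_ (dcoord y (Fin.last d)) (2*j)).mul
      (dpowinv (dww' y) (by simpa using (ww_pos hy).ne') k)
    simp only [gg]
    refine HasDerivAt.congr_deriv h ?_
    simp
    ring
  · have h := (((dpow_ (dcoord x (Fin.last d)) (2*j-1)).mul
      (dpowinv (dww' x) (by simpa using (ww_pos hx).ne') k)).const_mul ((2*j : ℕ):ℝ)).sub
      (((dpow_ (dcoord x (Fin.last d)) (2*j+1)).mul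
      (dpowinv (dww' x) (by simpa using (ww_pos hx).ne') (k+1))).const_mul (3/2 * k : ℝ))
    refine HasDerivAt.congr_deriv h ?_
    rcases j with _ | j
    · simp [gg]
      ring
    · have e1 : 2 * (j+1) - 1 = 2*j+1 := by omega
      have e2 : 2 * (j+1) - 1 - 1 = 2*j := by omega
      simp only [gg, e1, e2, Nat.add_sub_cancel]
      simp
      ring

lemma Dp_gg {d : ℕ} (j k : ℕ) {x : En (d+1)} (hx : x ≠ 0) :
    ∑ i : Fin d, dd (stdB (d+1) i.castSucc) (gg j k) x
      = 2 * k * (2 * k + 2 - d) * gg j (k+1) x - 3 * k * (k+1) * gg (j+1) (k+2) x := by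
  simp only [dd_gg j k hx, Finset.sum_add_distrib, Finset.sum_const, Finset.card_univ,
    Fintype.card_fin, nsmul_eq_mul]
  rw [← Finset.sum_mul, ← Finset.mul_sum]
  have : ∑ i : Fin d, x i.castSucc ^ 2 = ww x - 3/4 * x (Fin.last d)^2 := by unfold ww; ring
  rw [this]
  unfold gg
  have := (ww_pos hx).ne'
  field_simp
  ring
def Dp {d : ℕ} (f : En (d+1) → ℝ) (x : En (d+1)) : ℝ :=
  ∑ i : Fin d, dd (stdB (d+1) i.castSucc) f x

def Ds {d : ℕ} (f : En (d+1) → ℝ) (x : En (d+1)) : ℝ := dd (stdB (d+1) (Fin.last d)) f x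

lemma Dp_congr {d : ℕ} {f g : En (d+1) → ℝ} (h : ∀ y, y ≠ 0 → f y = g y) {x : En (d+1)}
    (hx : x ≠ 0) : Dp f x = Dp g x := Finset.sum_congr rfl (fun _ _ => dd_congr h _ hx)

lemma Ds_congr {d : ℕ} {f g : En (d+1) → ℝ} (h : ∀ y, y ≠ 0 → f y = g y) {x : En (d+1)}
    (hx : x ≠ 0) : Ds f x = Ds g x := dd_congr h _ hx

lemma Sm.Dp {d : ℕ} {f : En (d+1) → ℝ} (hf : Sm f) : Sm (Dp f) :=
  Sm.sum _ (fun _ => hf.dd _)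

lemma Sm.Ds {d : ℕ} {f : En (d+1) → ℝ} (hf : Sm f) : Sm (Ds f) := hf.dd _

lemma Dp_lin {d : ℕ} {f g : En (d+1) → ℝ} (hf : Sm f) (hg : Sm g) (c e : ℝ) {x : En (d+1)}
    (hx : x ≠ 0) : Dp (fun y => c * f y + e * g y) x = c * Dp f x + e * Dp g x := by
  unfold Dp
  simp only [dd_lin hf hg c e _ hx, Finset.sum_add_distrib, Finset.mul_sum]

lemma Ds_lin {d : ℕ} {f g : En (d+1) → ℝ} (hf : Sm f) (hg : Sm g) (c e : ℝ) {x : En (d+1)}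
    (hx : x ≠ 0) : Ds (fun y => c * f y + e * g y) x = c * Ds f x + e * Ds g x :=
  dd_lin hf hg c e _ hx

lemma Lg_eq {d : ℕ} {γ : ℝ} {f : En (d+1) → ℝ} (hf : Sm f) {x : En (d+1)} (hx : x ≠ 0) :
    Lgamma d γ f x = Dp (Dp f) x + 2 * Real.cos γ * Dp (Ds f) x + Ds (Ds f) x := by
  unfold Lgamma
  simp only [it_four hf hx]
  congr 2
  unfold Dp
  refine Finset.sum_congr rfl (fun i _ => ?_)
  rw [dd_sum _ (fun j => hf.dd _) _ hx]

lemma Dpg {d : ℕ} (j k : ℕ) {x : En (d+1)} (hx : x ≠ 0) :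
    Dp (gg j k) x = (2 * k * (2 * k + 2 - d)) * gg j (k+1) x
      + (- 3 * k * (k+1)) * gg (j+1) (k+2) x := by
  unfold Dp
  rw [Dp_gg j k hx]; ring

lemma Dsg {d : ℕ} (j k : ℕ) {x : En (d+1)} (hx : x ≠ 0) :
    Ds (gg j k) x = 1 * ((2 * j * (2 * j - 1)) * gg (j-1) k x
        + (- 3/2 * k * (4 * j + 1)) * gg j (k+1) x)
        + (9/4 * k * (k+1)) * gg (j+1) (k+2) x := by
  unfold Ds
  rw [dd_gg' j k hx]; ring

lemma DpDp {d : ℕ} (j k : ℕ) {x : En (d+1)} (hx : x ≠ 0) :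
    Dp (Dp (gg j k)) x = (2 * k * (2 * k + 2 - d)) * Dp (gg j (k+1)) x
      + (- 3 * k * (k+1)) * Dp (gg (j+1) (k+2)) x := by
  rw [Dp_congr (fun y hy => Dpg j k hy) hx, Dp_lin (gg_sm _ _) (gg_sm _ _) _ _ hx]

lemma DpDs {d : ℕ} (j k : ℕ) {x : En (d+1)} (hx : x ≠ 0) :
    Dp (Ds (gg j k)) x = 1 * ((2 * j * (2 * j - 1)) * Dp (gg (j-1) k) x
        + (- 3/2 * k * (4 * j + 1)) * Dp (gg j (k+1)) x)
        + (9/4 * k * (k+1)) * Dp (gg (j+1) (k+2)) x := by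
  rw [Dp_congr (fun y hy => Dsg j k hy) hx,
    Dp_lin ((gg_sm _ _).lin (gg_sm _ _) _ _) (gg_sm _ _) _ _ hx,
    Dp_lin (gg_sm _ _) (gg_sm _ _) _ _ hx]

lemma DsDs {d : ℕ} (j k : ℕ) {x : En (d+1)} (hx : x ≠ 0) :
    Ds (Ds (gg j k)) x = 1 * ((2 * j * (2 * j - 1)) * Ds (gg (j-1) k) x
        + (- 3/2 * k * (4 * j + 1)) * Ds (gg j (k+1)) x)
        + (9/4 * k * (k+1)) * Ds (gg (j+1) (k+2)) x := by
  rw [Ds_congr (fun y hy => Dsg j k hy) hx,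
    Ds_lin ((gg_sm _ _).lin (gg_sm _ _) _ _) (gg_sm _ _) _ _ hx,
    Ds_lin (gg_sm _ _) (gg_sm _ _) _ _ hx]

def hh {d : ℕ} (x : En (d+1)) : ℝ := 1 * gg 1 1 x + 11/20 * gg 2 2 x

lemma hh_sm {d : ℕ} : Sm (hh : En (d+1) → ℝ) := (gg_sm 1 1).lin (gg_sm 2 2) _ _

lemma poly_pos (u v e : ℝ) (hu : 0 ≤ u) (hv : 0 ≤ v) (he : 0 ≤ e) (h : 0 < u + v) :
    0 < (12/5 * u^4 - 3721/50 * u^3*v + 72801/100 * u^2*v^2 - 176229/160 * u*v^3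
        + 147933/320 * v^4)
      + e * (36/5 * u^4 + 378/25 * u^3*v - 4143/50 * u^2*v^2 + 25533/200 * u*v^3
        + 234333/1600 * v^4)
      + e^2 * (8 * u^3*v + 156/5 * u^2*v^2 + 333/10*u*v^3 + 54/5 * v^4) := by
  have h1 : 0 < 12/5 * u^4 - 3721/50 * u^3*v + 72801/100 * u^2*v^2 - 176229/160 * u*v^3
        + 147933/320 * v^4 := by
    have e1 : 12/5 * u^4 - 3721/50 * u^3*v + 72801/100 * u^2*v^2 - 176229/160 * u*v^3
        + 147933/320 * v^4 = 12/5 * (u^2 - 3721/240*u*v + 64/5*v^2)^2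
        + (89 * (u*v - 83/100*v^2)^2 + (72801/100 - 12/5*((3721/240)^2+2*64/5) - 89) * (u*v)^2
        + (- 176229/160 + 2*(12/5)*(3721/240)*(64/5) + 89*2*(83/100)) * (u*v)*v^2
        + (147933/320 - 12/5*(64/5)^2 - 89*(83/100)^2) * v^4) := by ring
    rw [e1]
    rcases hv.eq_or_lt with hv | hv
    · subst hv
      have : 0 < u := by linarith
      norm_num
      positivity
    · have : 0 < v^4 := by positivity
      have h3 : 0 ≤ (u*v)*v^2 := by positivity
      nlinarith [sq_nonneg (u^2 - 3721/240*u*v + 64/5*v^2), sq_nonneg (u*v - 83/100*v^2),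
        sq_nonneg (u*v - v^2)]
  have h2 : 0 ≤ 36/5 * u^4 + 378/25 * u^3*v - 4143/50 * u^2*v^2 + 25533/200 * u*v^3
        + 234333/1600 * v^4 := by
    have a1 : 0 ≤ u^3*v := by positivity
    have a2 : 0 ≤ u*v^3 := by positivity
    have a3 : 0 ≤ u*v*(u-2*v)^2 := by positivity
    nlinarith [sq_nonneg (u^2 - 3*v^2), sq_nonneg (u*v), sq_nonneg (v^2), a3, a1, a2,
      sq_nonneg (u^2 - u*v), sq_nonneg (u*v-v^2), sq_nonneg (u^2+u*v-4*v^2)]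
  have h3 : 0 ≤ 8 * u^3*v + 156/5 * u^2*v^2 + 333/10*u*v^3 + 54/5 * v^4 := by positivity
  have := mul_nonneg he h2
  have := mul_nonneg (sq_nonneg e) h3
  linarith

lemma Lhh_pos {d : ℕ} (hd : 5 ≤ d) {γ : ℝ} (hγ : Real.cos γ = -9/10) {x : En (d+1)}
    (hx : x ≠ 0) : 0 < Lgamma d γ hh x := by
  rw [Lg_eq hh_sm hx]
  have e1 : ∀ y : En (d+1), y ≠ 0 → Dp hh y = 1 * Dp (gg 1 1) y + 11/20 * Dp (gg 2 2) y :=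
    fun y hy => Dp_lin (gg_sm _ _) (gg_sm _ _) _ _ hy
  have e2 : ∀ y : En (d+1), y ≠ 0 → Ds hh y = 1 * Ds (gg 1 1) y + 11/20 * Ds (gg 2 2) y :=
    fun y hy => Ds_lin (gg_sm _ _) (gg_sm _ _) _ _ hy
  rw [Dp_congr e1 hx, Dp_congr e2 hx, Ds_congr e2 hx,
    Dp_lin (gg_sm _ _).Dp (gg_sm _ _).Dp _ _ hx, Dp_lin (gg_sm _ _).Ds (gg_sm _ _).Ds _ _ hx,
    Ds_lin (gg_sm _ _).Ds (gg_sm _ _).Ds _ _ hx]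
  simp only [DpDp _ _ hx, DpDs _ _ hx, DsDs _ _ hx, Dpg _ _ hx, Dsg _ _ hx]
  norm_num only
  have hw := ww_pos hx
  obtain ⟨e, he, hde⟩ : ∃ e : ℝ, 0 ≤ e ∧ (d : ℝ) = 5 + e :=
    ⟨d - 5, by have : (5:ℝ) ≤ d := by exact_mod_cast hd
               linarith, by ring⟩
  have hu : 0 ≤ ∑ i : Fin d, x i.castSucc ^ 2 := Finset.sum_nonneg (fun i _ => sq_nonneg _)
  have hv : 0 ≤ x (Fin.last d) ^ 2 := sq_nonneg _
  have hwe : ww x = (∑ i : Fin d, x i.castSucc ^ 2) + 3/4 * x (Fin.last d) ^ 2 := rfl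
  set u := ∑ i : Fin d, x i.castSucc ^ 2
  have hp := poly_pos u (x (Fin.last d) ^ 2) e hu hv he (by linarith)
  have hp2 := div_pos hp (pow_pos hw 6)
  refine hp2.trans_eq ?_
  simp only [gg, hγ, hde]
  have hu' : u = ww x - 3/4 * x (Fin.last d) ^ 2 := by rw [hwe]; ring
  rw [hu']
  have hw' := hw.ne'
  field_simp
  norm_num
  ring
lemma Lg_congr {d : ℕ} {γ : ℝ} {f g : En (d+1) → ℝ} {x : En (d+1)} (h : f =ᶠ[𝓝 x] g) :
    Lgamma d γ f x = Lgamma d γ g x := by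
  unfold Lgamma
  rw [(h.iteratedFDeriv ℝ 4).eq_of_nhds]

lemma Lg_sub {d : ℕ} {γ : ℝ} {f g : En (d+1) → ℝ} (hf : ContDiff ℝ ∞ f) (hg : ContDiff ℝ ∞ g)
    (x : En (d+1)) : Lgamma d γ (fun y => f y - g y) x = Lgamma d γ f x - Lgamma d γ g x := by
  have h : iteratedFDeriv ℝ 4 (fun y => f y - g y) x
      = iteratedFDeriv ℝ 4 f x - iteratedFDeriv ℝ 4 g x :=
    iteratedFDeriv_sub_apply ((contDiff_infty.mp hf 4).contDiffAt)
      ((contDiff_infty.mp hg 4).contDiffAt)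
  unfold Lgamma
  rw [h]
  simp only [ContinuousMultilinearMap.sub_apply, Finset.sum_sub_distrib]
  ring

lemma Lg_half {d : ℕ} {γ : ℝ} {f : En (d+1) → ℝ} (hf : ContDiff ℝ ∞ f) (c : ℝ)
    (x : En (d+1)) : Lgamma d γ (fun y => f (c • y)) x = c^4 * Lgamma d γ f (c • x) := by
  have h := iteratedFDeriv_comp_const_smul (i := 4) c
    (contDiff_infty.mp hf 4)
  unfold Lgamma
  rw [h]
  simp only [ContinuousMultilinearMap.smul_apply, smul_eq_mul, ← Finset.mul_sum]
  ring

lemma Lg_cont {d : ℕ} {γ : ℝ} {f : En (d+1) → ℝ} (hf : ContDiff ℝ ∞ f) :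
    Continuous (Lgamma d γ f) := by
  have h : Continuous (iteratedFDeriv ℝ 4 f) :=
    (contDiff_infty.mp hf 4).continuous_iteratedFDeriv le_rfl
  have h2 : ∀ m, Continuous (fun x => iteratedFDeriv ℝ 4 f x m) := fun m =>
    (ContinuousMultilinearMap.apply ℝ (fun _ : Fin 4 => En (d+1)) ℝ m).continuous.comp h
  unfold Lgamma
  exact ((continuous_finset_sum _ (fun i _ => continuous_finset_sum _ (fun j _ => h2 _))).add
    (continuous_const.mul (continuous_finset_sum _ (fun i _ => h2 _)))).add (h2 _)

lemma hh_homog {d : ℕ} (c : ℝ) (hc : c ≠ 0) (x : En (d+1)) : hh (c • x) = hh x := by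
  have hw : ww (c • x) = c^2 * ww x := by
    unfold ww
    simp only [PiLp.smul_apply, smul_eq_mul, mul_pow, ← Finset.mul_sum]
    ring
  unfold hh gg
  rw [hw]
  simp only [PiLp.smul_apply, smul_eq_mul, mul_pow, mul_inv]
  field_simp
  ring

def bump (n : ℕ) : ContDiffBump (0 : En n) := ⟨1, 3/2, by norm_num, by norm_num⟩

def HH {d : ℕ} (x : En (d+1)) : ℝ := hh x * (1 - bump (d+1) x)

lemma HH_smooth {d : ℕ} : ContDiff ℝ ∞ (HH : En (d+1) → ℝ) := by
  rw [contDiff_iff_contDiffAt]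
  intro y
  by_cases hy : y = 0
  · subst hy
    have : (HH : En (d+1) → ℝ) =ᶠ[𝓝 0] fun _ => 0 := by
      filter_upwards [(bump (d+1)).eventuallyEq_one] with z hz
      simp [HH, hz]
    exact contDiffAt_const.congr_of_eventuallyEq this
  · exact (hh_sm y hy).mul (contDiffAt_const.sub (bump (d+1)).contDiffAt)

lemma HH_far {d : ℕ} {x : En (d+1)} (hx : 3/2 ≤ ‖x‖) : HH x = hh x := by
  have : bump (d+1) x = 0 := (bump (d+1)).zero_of_le_dist (by simpa [bump] using hx)
  simp [HH, this]

lemma HH_pos {d : ℕ} (hd : 5 ≤ d) {γ : ℝ} (hγ : Real.cos γ = -9/10) {x : En (d+1)}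
    (hx : 2 ≤ ‖x‖) : 0 < Lgamma d γ HH x := by
  have hx0 : x ≠ 0 := by rintro rfl; norm_num at hx
  rw [Lg_congr (g := hh)]
  · exact Lhh_pos hd hγ hx0
  · have : ∀ᶠ y in 𝓝 x, 3/2 < ‖y‖ :=
      continuous_norm.continuousAt.eventually (lt_mem_nhds (by linarith))
    filter_upwards [this] with y hy using HH_far hy.le

lemma HH_half {d : ℕ} {x : En (d+1)} (hx : 3 ≤ ‖x‖) : HH ((1/2 : ℝ) • x) = HH x := by
  rw [HH_far (x := x) (by linarith), HH_far, hh_homog _ (by norm_num)]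
  rw [norm_smul]; norm_num; linarith

lemma LHH_half {d : ℕ} {γ : ℝ} {x : En (d+1)} (hx : 4 ≤ ‖x‖) :
    Lgamma d γ HH x = 1/16 * Lgamma d γ HH ((1/2 : ℝ) • x) := by
  have h := Lg_half (γ := γ) (HH_smooth (d := d)) (1/2) x
  have h2 : (1/2:ℝ)^4 = 1/16 := by norm_num
  rw [h2] at h
  rw [← h]
  apply Lg_congr
  have : ∀ᶠ y in 𝓝 x, 3 < ‖y‖ :=
    continuous_norm.continuousAt.eventually (lt_mem_nhds (by linarith))
  filter_upwards [this] with y hy using (HH_half hy.le).symm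

lemma psi_zero {d : ℕ} {γ : ℝ} {K : En (d+1) → ℝ}
    (hK : ∀ ψ : En (d+1) → ℝ, ContDiff ℝ (⊤ : ℕ∞) ψ → HasCompactSupport ψ →
          ∫ y, K y * Lgamma d γ ψ y = ψ 0) :
    ∫ y, K y * (Lgamma d γ HH y - 1/16 * Lgamma d γ HH ((1/2 : ℝ) • y)) = 0 := by
  have hs : ContDiff ℝ ∞ (fun y : En (d+1) => HH ((1/2:ℝ) • y)) :=
    HH_smooth.comp (contDiff_const_smul _)
  have h := hK (fun y => HH y - HH ((1/2 : ℝ) • y)) (HH_smooth.sub hs) ?_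
  · simp only [Lg_sub HH_smooth hs, Lg_half HH_smooth, smul_zero, sub_self] at h
    rw [← h]
    norm_num
  · apply HasCompactSupport.intro (isCompact_closedBall (0 : En (d+1)) 3)
    intro x hx
    have : 3 ≤ ‖x‖ := by
      simp at hx; exact hx.le
    rw [HH_half this, sub_self]

lemma annulus_int {d : ℕ} {K A : En (d+1) → ℝ} (hKi : LocallyIntegrable K volume)
    (hKh : HomogeneousDeg (d+1) ((4 : ℝ) - (d+1)) K) (hA : Continuous A)
    (hA4 : ∀ x, 4 ≤ ‖x‖ → A x = 1/16 * A ((1/2 : ℝ) • x))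
    (h0 : ∫ y, K y * (A y - 1/16 * A ((1/2 : ℝ) • y)) = 0) :
    ∫ y in {x | 2 ≤ ‖x‖ ∧ ‖x‖ < 4}, K y * A y = 0 := by
  have hms : MeasurableSet {x : En (d+1) | 2 ≤ ‖x‖ ∧ ‖x‖ < 4} :=
    (measurableSet_le measurable_const measurable_norm).inter
      (measurableSet_lt measurable_norm measurable_const)
  have hmb : MeasurableSet {x : En (d+1) | ‖x‖ < 2} :=
    measurableSet_lt measurable_norm measurable_const
  have hint : ∀ R : ℝ, IntegrableOn (fun y => K y * A y) (Metric.closedBall 0 R) := fun R =>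
    (hKi.integrableOn_isCompact (isCompact_closedBall _ _)).mul_continuousOn hA.continuousOn
      (isCompact_closedBall _ _)
  set G : En (d+1) → ℝ := Set.indicator {x | ‖x‖ < 2} (fun y => K y * A y) with hG
  have hGi : Integrable G := by
    rw [hG, integrable_indicator_iff hmb]
    exact (hint 2).mono_set (fun x hx => by simpa using (le_of_lt hx : ‖x‖ ≤ 2))
  have hGi2 : Integrable (fun x => G ((1/2:ℝ) • x)) := hGi.comp_smul (by norm_num)
  have hFi : Integrable (Set.indicator {x : En (d+1) | 2 ≤ ‖x‖ ∧ ‖x‖ < 4}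
      (fun y => K y * A y)) := by
    rw [integrable_indicator_iff hms]
    exact (hint 4).mono_set (fun x hx => by simpa using hx.2.le)
  set c : ℝ := (2:ℝ) ^ ((4:ℝ) - (d+1)) with hc
  have key : (fun y => K y * (A y - 1/16 * A ((1/2 : ℝ) • y))) =ᵐ[volume]
      fun y => (G y - (c/16) * G ((1/2:ℝ) • y))
        + Set.indicator {x : En (d+1) | 2 ≤ ‖x‖ ∧ ‖x‖ < 4} (fun y => K y * A y) y := by
    have hne : ∀ᵐ y : En (d+1), y ≠ 0 := compl_mem_ae_iff.mpr (measure_singleton _)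
    filter_upwards [hne] with y hy
    have hK2 : K y = c * K ((1/2:ℝ) • y) := by
      have := hKh 2 (by norm_num) ((1/2:ℝ) • y) (by simpa using hy)
      rw [smul_smul] at this
      norm_num at this
      rw [hc]
      norm_num
      exact this
    have hn : ‖(1/2:ℝ) • y‖ = ‖y‖ / 2 := by
      rw [norm_smul]; norm_num; ring
    by_cases h2 : ‖y‖ < 2
    · have m1 : y ∈ {x : En (d+1) | ‖x‖ < 2} := h2
      have m2 : (1/2:ℝ) • y ∈ {x : En (d+1) | ‖x‖ < 2} := by
        simp only [Set.mem_setOf_eq, hn]; linarith [norm_nonneg y]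
      have m3 : y ∉ {x : En (d+1) | 2 ≤ ‖x‖ ∧ ‖x‖ < 4} := fun h => absurd h.1 (not_le.mpr h2)
      rw [hG, Set.indicator_of_mem m1, Set.indicator_of_mem m2, Set.indicator_of_notMem m3]
      rw [hK2]; ring
    · push Not at h2
      have m1 : y ∉ {x : En (d+1) | ‖x‖ < 2} := fun h => absurd h (not_lt.mpr h2)
      by_cases h4 : ‖y‖ < 4
      · have m2 : (1/2:ℝ) • y ∈ {x : En (d+1) | ‖x‖ < 2} := by
          simp only [Set.mem_setOf_eq, hn]; linarith
        have m3 : y ∈ {x : En (d+1) | 2 ≤ ‖x‖ ∧ ‖x‖ < 4} := ⟨h2, h4⟩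
        rw [hG, Set.indicator_of_notMem m1, Set.indicator_of_mem m2, Set.indicator_of_mem m3]
        rw [hK2]; ring
      · push Not at h4
        have m2 : (1/2:ℝ) • y ∉ {x : En (d+1) | ‖x‖ < 2} := by
          simp only [Set.mem_setOf_eq, hn]; linarith
        have m3 : y ∉ {x : En (d+1) | 2 ≤ ‖x‖ ∧ ‖x‖ < 4} := fun h => absurd h.2 (not_lt.mpr h4)
        rw [hG, Set.indicator_of_notMem m1, Set.indicator_of_notMem m2, Set.indicator_of_notMem m3,
          hA4 y h4]
        ring
  have hS : Integrable (fun y => G y - (c/16) * G ((1/2:ℝ) • y)) := hGi.sub (hGi2.const_mul _)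
  rw [integral_congr_ae key, integral_add hS hFi,
    integral_sub hGi (hGi2.const_mul _), integral_const_mul, Measure.integral_comp_smul,
    integral_indicator hms] at h0
  have hcc : c / 16 * |(((1/2:ℝ)) ^ Module.finrank ℝ (En (d+1)))⁻¹| = 1 := by
    rw [finrank_euclideanSpace_fin, abs_of_pos (by positivity), hc]
    have : (4:ℝ) - (d+1) = (4:ℕ) - ((d+1 : ℕ):ℝ) := by push_cast; ring
    rw [this, Real.rpow_sub (by norm_num), Real.rpow_natCast, Real.rpow_natCast]
    rw [one_div, inv_pow, inv_inv]
    field_simp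
    norm_num
  rw [smul_eq_mul, ← mul_assoc, hcc] at h0
  linarith

lemma no_sign {d : ℕ} (hd : 5 ≤ d) {γ : ℝ} (hγ : Real.cos γ = -9/10) {K : En (d+1) → ℝ}
    (hKi : LocallyIntegrable K volume) (hKc : ContinuousOn K {(0 : En (d+1))}ᶜ)
    (hKh : HomogeneousDeg (d+1) ((4 : ℝ) - (d+1)) K)
    (hK : ∀ ψ : En (d+1) → ℝ, ContDiff ℝ (⊤ : ℕ∞) ψ → HasCompactSupport ψ →
          ∫ y, K y * Lgamma d γ ψ y = ψ 0)
    (σ : ℝ) (hσ : σ ≠ 0) (hs : ∀ y, y ≠ 0 → 0 ≤ σ * K y) : False := by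
  have hcont : Continuous (Lgamma d γ (HH (d := d))) := Lg_cont HH_smooth
  have h1 := annulus_int hKi hKh hcont (fun x hx => LHH_half hx) (psi_zero hK)
  have hms : MeasurableSet {x : En (d+1) | 2 ≤ ‖x‖ ∧ ‖x‖ < 4} :=
    (measurableSet_le measurable_const measurable_norm).inter
      (measurableSet_lt measurable_norm measurable_const)
  have hint : IntegrableOn (fun y => σ * (K y * Lgamma d γ HH y))
      {x : En (d+1) | 2 ≤ ‖x‖ ∧ ‖x‖ < 4} := by
    refine (((hKi.integrableOn_isCompact (isCompact_closedBall 0 4)).mul_continuousOn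
      hcont.continuousOn (isCompact_closedBall _ _)).mono_set
      (fun x hx => by simpa using hx.2.le)).const_mul σ
  have h2 : ∫ y in {x : En (d+1) | 2 ≤ ‖x‖ ∧ ‖x‖ < 4}, σ * (K y * Lgamma d γ HH y) = 0 := by
    rw [integral_const_mul, h1, mul_zero]
  have hn0 : ∀ y : En (d+1), 2 ≤ ‖y‖ → y ≠ 0 := by
    rintro y hy rfl; norm_num at hy
  rw [setIntegral_eq_zero_iff_of_nonneg_ae ?_ hint] at h2
  swap
  · filter_upwards [ae_restrict_mem hms] with y hy
    have a := hs y (hn0 y hy.1)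
    have b := HH_pos hd hγ hy.1
    have := mul_nonneg a b.le
    simpa [mul_assoc] using this
  have hU : IsOpen {x : En (d+1) | 2 < ‖x‖ ∧ ‖x‖ < 4} :=
    (isOpen_lt continuous_const continuous_norm).inter
      (isOpen_lt continuous_norm continuous_const)
  have h3 : K =ᵐ[volume.restrict {x : En (d+1) | 2 < ‖x‖ ∧ ‖x‖ < 4}] (fun _ => 0) := by
    have hsub : {x : En (d+1) | 2 < ‖x‖ ∧ ‖x‖ < 4} ⊆ {x | 2 ≤ ‖x‖ ∧ ‖x‖ < 4} :=
      fun x hx => ⟨hx.1.le, hx.2⟩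
    have h2' := ae_restrict_of_ae_restrict_of_subset hsub h2
    filter_upwards [h2', ae_restrict_mem hU.measurableSet] with y hy hy2
    have b := (HH_pos hd hγ hy2.1.le).ne'
    simpa [hσ, b] using hy
  have h4 := Measure.eqOn_open_of_ae_eq h3 hU
    (hKc.mono (fun x hx => hn0 x hx.1.le)) continuousOn_const
  have h5 : ∀ y, y ≠ 0 → K y = 0 := by
    intro y hy
    have hny : 0 < ‖y‖ := norm_pos_iff.mpr hy
    have hz : (3 / ‖y‖) • y ∈ {x : En (d+1) | 2 < ‖x‖ ∧ ‖x‖ < 4} := by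
      have : ‖(3 / ‖y‖) • y‖ = 3 := by
        rw [norm_smul, norm_div, norm_norm]
        field_simp
        norm_num
      simp only [Set.mem_setOf_eq, this]; norm_num
    have a := h4 hz
    have b := hKh (3 / ‖y‖) (by positivity) y hy
    rw [a] at b
    have : 0 < |3 / ‖y‖| ^ ((4:ℝ) - (d+1)) := Real.rpow_pos_of_pos (by positivity) _
    simpa [this.ne'] using b.symm
  have h6 := hK (bump (d+1)) (bump (d+1)).contDiff (bump (d+1)).hasCompactSupport
  have h7 : bump (d+1) 0 = 1 := (bump (d+1)).eventuallyEq_one.eq_of_nhds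
  have h8 : ∫ y, K y * Lgamma d γ (bump (d+1)) y = 0 := by
    rw [integral_eq_zero_of_ae]
    have hne : ∀ᵐ y : En (d+1), y ≠ 0 := compl_mem_ae_iff.mpr (measure_singleton _)
    filter_upwards [hne] with y hy
    simp [h5 y hy]
  rw [h8, h7] at h6
  norm_num at h6

/-- For every n = d+1 ≥ 6 there is γ ∈ (0,π) such that every
(4−n)-homogeneous fundamental solution of L_γ changes sign. -/
theorem stmt16 (d : ℕ) (hd : 6 ≤ d + 1) :
    ∃ γ : ℝ, γ ∈ Set.Ioo 0 Real.pi ∧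
      ∀ K : En (d+1) → ℝ,
        LocallyIntegrable K volume →
        ContinuousOn K {(0 : En (d+1))}ᶜ →
        HomogeneousDeg (d+1) ((4 : ℝ) - (d+1)) K →
        (∀ ψ : En (d+1) → ℝ, ContDiff ℝ (⊤ : ℕ∞) ψ → HasCompactSupport ψ →
          ∫ y, K y * Lgamma d γ ψ y = ψ 0) →
        (∃ y : En (d+1), y ≠ 0 ∧ 0 < K y) ∧ (∃ z : En (d+1), z ≠ 0 ∧ K z < 0) := by
  refine ⟨Real.arccos (-9/10), ⟨Real.arccos_pos.mpr (by norm_num), ?_⟩, ?_⟩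
  · refine lt_of_le_of_ne (Real.arccos_le_pi _) (fun h => ?_)
    rw [Real.arccos_eq_pi] at h
    norm_num at h
  · intro K hKi hKc hKh hK
    have hγ : Real.cos (Real.arccos (-9/10)) = -9/10 :=
      Real.cos_arccos (by norm_num) (by norm_num)
    constructor
    · by_contra! h
      exact no_sign (by omega) hγ hKi hKc hKh hK (-1) (by norm_num)
        (fun y hy => by linarith [h y hy])
    · by_contra! h
      exact no_sign (by omega) hγ hKi hKc hKh hK 1 (by norm_num)
        (fun y hy => by linarith [h y hy])
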